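/- Let 𝔽 = ℝ or ℂ and let N > d ≥ 1. Then the set of non-orthodecomposable frames in 𝓕_{N,d}^𝔽 is path-connected if and only if the set of non-orthodecomposable frames in 𝓕_{N,N−d}^𝔽 is path-connected. -/

import Mathlib

noncomputable section

/-- The set of finite unit norm tight frames (FUNTFs) of `N` vectors in `𝕜^d`,
viewed as `d × N` matrices `F` with unit-norm columns and `F * Fᴴ = (N/d) • 1`. -/
def FUNTF (𝕜 : Type*) [RCLike 𝕜] (N d : ℕ) : Set (Matrix (Fin d) (Fin N) 𝕜) :=
  {F | F * F.conjTranspose = ((N : 𝕜) / (d : 𝕜)) • 1 ∧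
       ∀ n, (F.conjTranspose * F) n n = 1}

/-- The `j`-th column of a matrix, as a vector in Euclidean space. -/
def col {𝕜 : Type*} [RCLike 𝕜] {m n : ℕ} (F : Matrix (Fin m) (Fin n) 𝕜) (j : Fin n) :
    EuclideanSpace 𝕜 (Fin m) :=
  (WithLp.equiv 2 (Fin m → 𝕜)).symm fun i => F i j

/-- A family of vectors is orthodecomposable (OD) if the index set admits a partition into
two nonempty sets `S`, `T` such that the span of the vectors indexed by `S` is the orthogonal
complement of the span of the vectors indexed by `T`. -/
def Orthodecomposable (𝕜 : Type*) [RCLike 𝕜] {E : Type*} [NormedAddCommGroup E]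
    [InnerProductSpace 𝕜 E] {ι : Type*} (f : ι → E) : Prop :=
  ∃ S T : Set ι, S.Nonempty ∧ T.Nonempty ∧ Disjoint S T ∧ S ∪ T = Set.univ ∧
    Submodule.span 𝕜 (f '' S) = (Submodule.span 𝕜 (f '' T))ᗮ

set_option linter.unusedSectionVars false
section helpers

open Matrix Topology

theorem JoinedIn.mapsTo {X Y : Type*} [TopologicalSpace X] [TopologicalSpace Y] {A : Set X}
    {B : Set Y} {x y : X} (h : JoinedIn A x y) {f : X → Y} (hf : ContinuousOn f A)
    (hm : ∀ a ∈ A, f a ∈ B) : JoinedIn B (f x) (f y) :=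
  (h.map_continuousOn hf).mono (by rintro _ ⟨a, ha, rfl⟩; exact hm a ha)

section lift

variable {𝕜 : Type*} [RCLike 𝕜] {m n : Type*} [Fintype m] [DecidableEq m] [Fintype n]
  [DecidableEq n]

/-- generalised Householder reflection -/
noncomputable def hh (u v : Matrix m n 𝕜) : Matrix n n 𝕜 := 1 - (u + v)ᴴ * (1 + u * vᴴ)⁻¹ * (u + v)

theorem hh_mul (u v : Matrix m n 𝕜) (hu : u * uᴴ = 1)
    (h : IsUnit (1 + u * vᴴ).det) : u * hh u v = - v := by
  have e : u * (u + v)ᴴ = 1 + u * vᴴ := by rw [conjTranspose_add, Matrix.mul_add, hu]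
  rw [hh, Matrix.mul_sub, Matrix.mul_one, ← Matrix.mul_assoc, ← Matrix.mul_assoc, e,
    Matrix.mul_nonsing_inv _ h, Matrix.one_mul]
  abel

theorem hh_unitary (u v : Matrix m n 𝕜) (hu : u * uᴴ = 1) (hv : v * vᴴ = 1)
    (h : IsUnit (1 + u * vᴴ).det) : hh u v * (hh u v)ᴴ = 1 := by
  set M := 1 + u * vᴴ with hM
  set Z := u + v with hZ
  have e : Z * Zᴴ = M + Mᴴ := by
    rw [hZ, hM]
    simp only [conjTranspose_add, Matrix.mul_add, Matrix.add_mul, hu, hv, conjTranspose_mul,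
      conjTranspose_conjTranspose, conjTranspose_one]
    abel
  have h' : IsUnit (Mᴴ).det := by
    rw [det_conjTranspose]; exact h.star
  have i1 : M⁻¹ * M = 1 := Matrix.nonsing_inv_mul _ h
  have i2 : Mᴴ * (Mᴴ)⁻¹ = 1 := Matrix.mul_nonsing_inv _ h'
  have hW : hh u v = 1 - Zᴴ * M⁻¹ * Z := rfl
  have hW' : (hh u v)ᴴ = 1 - Zᴴ * (Mᴴ)⁻¹ * Z := by
    rw [hW]
    simp only [conjTranspose_sub, conjTranspose_mul, conjTranspose_one,
      conjTranspose_conjTranspose, conjTranspose_nonsing_inv, Matrix.mul_assoc]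
  rw [hW', hW]
  have key : Zᴴ * M⁻¹ * Z * (Zᴴ * (Mᴴ)⁻¹ * Z) = Zᴴ * (Mᴴ)⁻¹ * Z + Zᴴ * M⁻¹ * Z := by
    calc _ = Zᴴ * (M⁻¹ * (Z * Zᴴ) * (Mᴴ)⁻¹) * Z := by simp only [Matrix.mul_assoc]
      _ = Zᴴ * ((M⁻¹ * M) * (Mᴴ)⁻¹ + M⁻¹ * (Mᴴ * (Mᴴ)⁻¹)) * Z := by
        rw [e]; simp only [Matrix.mul_assoc, Matrix.mul_add, Matrix.add_mul]
      _ = _ := by rw [i1, i2]; simp only [Matrix.mul_one, Matrix.one_mul, Matrix.mul_add, Matrix.add_mul]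
  rw [Matrix.sub_mul, Matrix.mul_sub, Matrix.mul_sub, key]
  simp

theorem hh_continuousOn (u : Matrix m n 𝕜) :
    ContinuousOn (hh u) {v | IsUnit (1 + u * vᴴ).det} := by
  intro v hv
  apply ContinuousAt.continuousWithinAt
  unfold hh
  have h1 : ContinuousAt (fun v : Matrix m n 𝕜 => (1 + u * vᴴ)⁻¹) v := by
    have c : ContinuousAt (fun v : Matrix m n 𝕜 => (1 + u * vᴴ)) v := by
      apply Continuous.continuousAt; fun_prop
    refine ContinuousAt.comp' (f := fun v : Matrix m n 𝕜 => (1 + u * vᴴ)) ?_ c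
    apply continuousAt_matrix_inv
    obtain ⟨w, hw⟩ := hv
    rw [← hw]
    exact NormedRing.inverse_continuousAt w
  have h2 : ContinuousAt (fun v : Matrix m n 𝕜 => (u + v)) v := by fun_prop
  have h3 : ContinuousAt (fun v : Matrix m n 𝕜 => (u + v)ᴴ) v := by
    apply Continuous.continuousAt; fun_prop
  have h4 : ContinuousAt (fun v : Matrix m n 𝕜 => (u + v)ᴴ * (1 + u * vᴴ)⁻¹) v := by
    have : Continuous (fun p : Matrix n m 𝕜 × Matrix m m 𝕜 => p.1 * p.2) := by fun_prop
    exact this.continuousAt.comp' (h3.prodMk h1)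
  have h5 : ContinuousAt (fun v : Matrix m n 𝕜 => (u + v)ᴴ * (1 + u * vᴴ)⁻¹ * (u + v)) v := by
    have : Continuous (fun p : Matrix n m 𝕜 × Matrix m n 𝕜 => p.1 * p.2) := by fun_prop
    exact this.continuousAt.comp' (h4.prodMk h2)
  exact continuousAt_const.sub h5

theorem unit_comm {T : Matrix n n 𝕜} (h : T * Tᴴ = 1) : Tᴴ * T = 1 := by
  rwa [mul_eq_one_comm]

theorem unit_mul {S T : Matrix n n 𝕜} (h : S * Sᴴ = 1) (h' : T * Tᴴ = 1) :
    (S * T) * (S * T)ᴴ = 1 := by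
  rw [conjTranspose_mul, Matrix.mul_assoc, ← Matrix.mul_assoc T, h', Matrix.one_mul, h]

/-- the lifting relation -/
def LiftRel (A : Set (Matrix m n 𝕜)) (x y : Matrix m n 𝕜) : Prop :=
  ∃ T : Matrix n n 𝕜, JoinedIn {T | T * Tᴴ = 1 ∧ x * T ∈ A} 1 T ∧ x * T = y

theorem LiftRel.trans {A : Set (Matrix m n 𝕜)} {x y z : Matrix m n 𝕜} (h : LiftRel A x y)
    (h' : LiftRel A y z) : LiftRel A x z := by
  obtain ⟨T, hT, rfl⟩ := h
  obtain ⟨R, hR, rfl⟩ := h'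
  refine ⟨T * R, hT.trans ?_, by rw [Matrix.mul_assoc]⟩
  have := hR.mapsTo (f := fun R => T * R) (B := {T | T * Tᴴ = 1 ∧ x * T ∈ A}) (by fun_prop) (by
    rintro a ⟨h1, h2⟩
    exact ⟨unit_mul hT.target_mem.1 h1, by rwa [← Matrix.mul_assoc]⟩)
  simpa using this

theorem LiftRel.symm {A : Set (Matrix m n 𝕜)} {x y : Matrix m n 𝕜} (h : LiftRel A x y) :
    LiftRel A y x := by
  obtain ⟨T, hT, rfl⟩ := h
  have hT1 := hT.target_mem.1
  refine ⟨Tᴴ, ?_, by rw [Matrix.mul_assoc, hT1, Matrix.mul_one]⟩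
  have := hT.symm.mapsTo (f := fun R => Tᴴ * R) (B := {R | R * Rᴴ = 1 ∧ x * T * R ∈ A})
    (by fun_prop) (by
    rintro a ⟨h1, h2⟩
    refine ⟨unit_mul (by rw [conjTranspose_conjTranspose]; exact unit_comm hT1) h1, ?_⟩
    rw [← Matrix.mul_assoc, Matrix.mul_assoc x, hT1, Matrix.mul_one]
    exact h2)
  simpa [unit_comm hT1] using this

theorem LiftRel.near {A : Set (Matrix m n 𝕜)} (hA : ∀ u ∈ A, u * uᴴ = 1) {x y : Matrix m n 𝕜}
    (h : JoinedIn (A ∩ {v | IsUnit (1 + x * vᴴ).det}) x y) : LiftRel A x y := by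
  obtain ⟨hx, hxu⟩ := h.source_mem
  obtain ⟨hy, hyu⟩ := h.target_mem
  have hx1 := hA x hx
  have ux := hh_unitary x x hx1 hx1 hxu
  have mx := hh_mul x x hx1 hxu
  have mx' : x * (hh x x)ᴴ = -x := by
    have : x * hh x x * (hh x x)ᴴ = - (x * (hh x x)ᴴ) := by rw [mx, Matrix.neg_mul]
    rw [Matrix.mul_assoc, ux, Matrix.mul_one] at this
    exact neg_eq_iff_eq_neg.mp this.symm
  have key : ∀ v ∈ A ∩ {v | IsUnit (1 + x * vᴴ).det}, x * ((hh x x)ᴴ * hh x v) = v := by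
    rintro v ⟨_, h2⟩
    rw [← Matrix.mul_assoc, mx', Matrix.neg_mul, hh_mul x v hx1 h2, neg_neg]
  refine ⟨(hh x x)ᴴ * hh x y, ?_, key _ h.target_mem⟩
  have := h.mapsTo (f := fun v => (hh x x)ᴴ * hh x v) (B := {T | T * Tᴴ = 1 ∧ x * T ∈ A}) ?_ ?_
  · simpa [unit_comm ux] using this
  · have c : Continuous (fun R : Matrix n n 𝕜 => (hh x x)ᴴ * R) := by fun_prop
    exact c.comp_continuousOn ((hh_continuousOn x).mono Set.inter_subset_right)
  · intro v hv
    refine ⟨unit_mul (by rw [conjTranspose_conjTranspose]; exact unit_comm ux)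
      (hh_unitary x v hx1 (hA v hv.1) hv.2), ?_⟩
    change x * ((hh x x)ᴴ * hh x v) ∈ A
    rw [key v hv]; exact hv.1

theorem liftRel_of_joinedIn {A : Set (Matrix m n 𝕜)} (hA : ∀ u ∈ A, u * uᴴ = 1)
    {x y : Matrix m n 𝕜} (h : JoinedIn A x y) : LiftRel A x y := by
  obtain ⟨γ', hγ'⟩ := h
  set γ : ℝ → Matrix m n 𝕜 := fun t => γ'.extend t with hγd
  have hγc : Continuous γ := γ'.extend.continuous
  have hγ : ∀ t, γ t ∈ A := fun t => hγ' _
  have key : ∀ s t : ℝ, LiftRel A (γ s) (γ t) := by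
    intro s t
    refine isPreconnected_univ.induction₂ (fun s t => LiftRel A (γ s) (γ t)) ?_
      (fun _ _ _ _ _ _ h h' => h.trans h') (fun _ _ _ _ h => h.symm)
      (Set.mem_univ s) (Set.mem_univ t)
    intro s _
    rw [nhdsWithin_univ]
    set f : ℝ → 𝕜 := fun t => (1 + γ s * (γ t)ᴴ).det with hf
    have hfc : Continuous f := by
      rw [hf]; fun_prop
    have ho : IsOpen {t | f t ≠ 0} := isOpen_ne.preimage hfc
    have hs : s ∈ {t | f t ≠ 0} := by
      show (1 + γ s * (γ s)ᴴ).det ≠ 0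
      rw [hA _ (hγ s), ← two_smul 𝕜 (1 : Matrix m m 𝕜), det_smul, det_one]
      simp
    obtain ⟨U, hU, hUp, hUs⟩ := (pathConnected_subset_basis ho hs).ex_mem
    change U ∈ 𝓝 s at hU
    filter_upwards [hU] with t ht
    apply LiftRel.near hA
    refine (hUp.joinedIn s (mem_of_mem_nhds hU) t ht).mapsTo hγc.continuousOn ?_
    intro a ha
    exact ⟨hγ a, (hUs ha : f a ≠ 0).isUnit⟩
  simpa [hγd] using key 0 1

end lift

section uconn

variable {𝕜 : Type*} [RCLike 𝕜]

theorem joinedIn_circle_mul {a b : 𝕜} (ha : JoinedIn {z : 𝕜 | z * star z = 1} a 1)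
    (hb : JoinedIn {z : 𝕜 | z * star z = 1} b 1) :
    JoinedIn {z : 𝕜 | z * star z = 1} (a * b) 1 := by
  have := (ha.mul hb).mono (V := {z : 𝕜 | z * star z = 1}) (by
    rintro _ ⟨x, hx, y, hy, rfl⟩
    have hx : x * star x = 1 := hx
    have hy : y * star y = 1 := hy
    show x * y * star (x * y) = 1
    rw [star_mul', mul_mul_mul_comm, hx, hy, one_mul])
  simpa using this

theorem det_circle {n : Type*} [Fintype n] [DecidableEq n] {T : Matrix n n 𝕜}
    (h : T * Tᴴ = 1) : T.det * star T.det = 1 := by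
  rw [← det_conjTranspose, ← det_mul, h, det_one]

theorem joinedIn_det {n : Type*} [Fintype n] [DecidableEq n] {S T : Matrix n n 𝕜}
    (h : JoinedIn {T : Matrix n n 𝕜 | T * Tᴴ = 1} S T) :
    JoinedIn {z : 𝕜 | z * star z = 1} S.det T.det :=
  h.mapsTo (f := det) (by fun_prop) (fun _ h => det_circle h)

/-- unitaries whose determinant is connected to one are connected to the identity. -/
def UConn (𝕜 : Type*) [RCLike 𝕜] (n : Type*) [Fintype n] [DecidableEq n] : Prop :=
  ∀ V : Matrix n n 𝕜, V * Vᴴ = 1 → JoinedIn {z : 𝕜 | z * star z = 1} V.det 1 →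
    JoinedIn {T : Matrix n n 𝕜 | T * Tᴴ = 1} V 1

theorem row_joined {n : Type*} [Fintype n] [DecidableEq n] (h : 1 < Fintype.card n)
    {u v : Matrix Unit n 𝕜} (hu : u * uᴴ = 1) (hv : v * vᴴ = 1) :
    JoinedIn {w : Matrix Unit n 𝕜 | w * wᴴ = 1} u v := by
  have hn : ∀ x : EuclideanSpace 𝕜 n, (Matrix.of fun (_ : Unit) i => x i) *
      (Matrix.of fun (_ : Unit) i => x i)ᴴ = (1 : Matrix Unit Unit 𝕜) ↔ ‖x‖ = 1 := by
    intro x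
    have e : ((Matrix.of fun (_ : Unit) i => x i) *
      (Matrix.of fun (_ : Unit) i => x i)ᴴ) () () = ((‖x‖ ^ 2 : ℝ) : 𝕜) := by
      rw [EuclideanSpace.norm_sq_eq, Matrix.mul_apply]
      push_cast
      refine Finset.sum_congr rfl fun i _ => ?_
      simp [RCLike.mul_conj]
    constructor
    · intro h
      rw [h] at e
      simp only [one_apply_eq] at e
      have : ‖x‖ ^ 2 = 1 := by exact_mod_cast e.symm
      nlinarith [norm_nonneg x]
    · intro h
      ext ⟨⟩ ⟨⟩
      rw [e, h]; simp
  have hr : 1 < Module.rank ℝ (EuclideanSpace 𝕜 n) := by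
    rw [← Module.finrank_eq_rank, ← Module.finrank_mul_finrank ℝ 𝕜, finrank_euclideanSpace]
    have : 0 < Module.finrank ℝ 𝕜 := Module.finrank_pos
    have : 1 < Module.finrank ℝ 𝕜 * Fintype.card n := by nlinarith
    exact_mod_cast this
  have hs := isPathConnected_sphere hr (0 : EuclideanSpace 𝕜 n) zero_le_one
  have hmem : ∀ w : Matrix Unit n 𝕜, w * wᴴ = 1 →
      (WithLp.toLp 2 (w ()) : EuclideanSpace 𝕜 n) ∈ Metric.sphere (0 : EuclideanSpace 𝕜 n) 1 := by
    intro w hw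
    rw [mem_sphere_zero_iff_norm, ← hn]
    exact hw
  have := (hs.joinedIn _ (hmem u hu) _ (hmem v hv)).mapsTo
    (f := fun x => (Matrix.of fun (_ : Unit) i => x i))
    (B := {w : Matrix Unit n 𝕜 | w * wᴴ = 1}) (by
      apply Continuous.continuousOn
      refine continuous_matrix fun _ i => ?_
      simp only [of_apply]
      fun_prop) (by
      intro x hx
      rw [mem_sphere_zero_iff_norm] at hx
      exact (hn x).2 hx)
  exact this

theorem UConn.sum {n : Type*} [Fintype n] [DecidableEq n] (h : UConn 𝕜 n) :
    UConn 𝕜 (Unit ⊕ n) := by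
  intro V hV hd
  set r : Matrix Unit (Unit ⊕ n) 𝕜 := V.submatrix Sum.inl id with hr
  set e : Matrix Unit (Unit ⊕ n) 𝕜 := fromCols 1 0 with he
  have hr1 : r * rᴴ = 1 := by
    have := congrArg (fun M => M.submatrix (Sum.inl : Unit → Unit ⊕ n) (Sum.inl : Unit → Unit ⊕ n)) hV
    ext i j
    have := congrFun (congrFun this i) j
    simpa [hr, Matrix.mul_apply] using this
  have he1 : e * eᴴ = 1 := by
    rw [he, conjTranspose_fromCols_eq_fromRows_conjTranspose, fromCols_mul_fromRows]; simp
  have hj : JoinedIn {w : Matrix Unit (Unit ⊕ n) 𝕜 | w * wᴴ = 1} r e := by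
    by_cases hc : 1 < Fintype.card (Unit ⊕ n)
    · exact row_joined hc hr1 he1
    · have : IsEmpty n := by
        rw [← Fintype.card_eq_zero_iff]
        simp at hc
        simpa using hc
      have := hd.mapsTo (f := fun z : 𝕜 => (Matrix.of fun (_ : Unit) (_ : Unit ⊕ n) => z))
        (B := {w : Matrix Unit (Unit ⊕ n) 𝕜 | w * wᴴ = 1}) (by
          apply Continuous.continuousOn
          refine continuous_matrix fun _ i => ?_
          simp only [of_apply]
          fun_prop) (by
          intro z hz
          ext ⟨⟩ ⟨⟩
          simpa [Matrix.mul_apply] using hz)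
      convert this using 1
      · ext i j
        rcases j with j | j
        · have hss : Subsingleton (Unit ⊕ n) := ⟨by
            rintro (a | a) (b | b)
            · rfl
            · exact isEmptyElim b
            · exact isEmptyElim a
            · exact isEmptyElim a⟩
          rw [det_eq_elem_of_subsingleton V (Sum.inl ())]; rfl
        · exact isEmptyElim j
      · ext i j
        rcases j with j | j
        · simp [he]
        · exact isEmptyElim j
  obtain ⟨T, hT, hrT⟩ := liftRel_of_joinedIn (fun u hu => hu) hj
  have hT' : JoinedIn {T : Matrix (Unit ⊕ n) (Unit ⊕ n) 𝕜 | T * Tᴴ = 1} 1 T :=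
    hT.mono fun _ h => h.1
  have hT1 : T * Tᴴ = 1 := hT.target_mem.1
  have hVT : JoinedIn {T : Matrix (Unit ⊕ n) (Unit ⊕ n) 𝕜 | T * Tᴴ = 1} V (V * T) := by
    have := hT'.mapsTo (f := fun R => V * R)
      (B := {T : Matrix (Unit ⊕ n) (Unit ⊕ n) 𝕜 | T * Tᴴ = 1})
      (by fun_prop) (fun R hR => unit_mul hV hR)
    simpa using this
  set X := V * T with hX
  have hX1 : X * Xᴴ = 1 := hVT.target_mem
  have hrow : ∀ j, X (Sum.inl ()) j = e () j := by
    intro j; rw [← hrT]; rfl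
  have h11 : X.toBlocks₁₁ = 1 := by
    ext i j; simp [toBlocks₁₁, hrow, he]
  have h12 : X.toBlocks₁₂ = 0 := by
    ext i j; simp [toBlocks₁₂, hrow, he]
  set D := X.toBlocks₂₂ with hD
  have hXb : X = fromBlocks 1 0 X.toBlocks₂₁ D := by
    rw [← h11, ← h12, hD, fromBlocks_toBlocks]
  have hX2 := hX1
  rw [hXb, fromBlocks_conjTranspose, fromBlocks_multiply, ← fromBlocks_one, fromBlocks_inj] at hX2
  obtain ⟨-, -, h21, h22⟩ := hX2
  simp only [conjTranspose_one, Matrix.mul_one, conjTranspose_zero, Matrix.mul_zero,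
    add_zero] at h21
  rw [h21] at hXb h22
  simp only [Matrix.zero_mul, zero_add] at h22
  have hdet : D.det = V.det * T.det := by
    rw [← det_mul, ← hX, hXb, det_fromBlocks_zero₁₂, det_one, one_mul]
  have hDj := h D h22 (by
    rw [hdet]
    refine joinedIn_circle_mul hd ?_
    simpa using (joinedIn_det hT').symm)
  refine hVT.trans ?_
  have := hDj.mapsTo (f := fun R => fromBlocks (1 : Matrix Unit Unit 𝕜) 0 0 R)
      (B := {T : Matrix (Unit ⊕ n) (Unit ⊕ n) 𝕜 | T * Tᴴ = 1})
      (by fun_prop) (by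
        intro R hR
        have hR : R * Rᴴ = 1 := hR
        simp [fromBlocks_conjTranspose, fromBlocks_multiply, hR])
  rw [hXb]
  simpa using this

theorem UConn.congr {n n' : Type*} [Fintype n] [DecidableEq n] [Fintype n'] [DecidableEq n']
    (e : n ≃ n') (h : UConn 𝕜 n) : UConn 𝕜 n' := by
  intro V hV hd
  have := h (V.submatrix e e) (by
    rw [conjTranspose_submatrix, submatrix_mul_equiv, hV, submatrix_one_equiv])
    (by rwa [det_submatrix_equiv_self])
  have := this.mapsTo (f := fun R => R.submatrix e.symm e.symm)
      (B := {T : Matrix n' n' 𝕜 | T * Tᴴ = 1}) (by fun_prop) (by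
      intro R hR
      have hR : R * Rᴴ = 1 := hR
      show R.submatrix e.symm e.symm * (R.submatrix e.symm e.symm)ᴴ = 1
      rw [conjTranspose_submatrix, submatrix_mul_equiv, hR, submatrix_one_equiv])
  simpa using this

theorem uconn_fin (n : ℕ) : UConn 𝕜 (Fin n) := by
  induction n with
  | zero =>
    intro V hV _
    have hV1 : V = 1 := Subsingleton.elim _ _
    rw [hV1] at hV ⊢
    exact JoinedIn.refl hV
  | succ n ih =>
    exact UConn.congr (((Equiv.optionEquivSumPUnit (Fin n)).trans
      (Equiv.sumComm _ _)).symm.trans (finSuccEquiv n).symm) ih.sum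

end uconn

section main

variable {𝕜 : Type*} [RCLike 𝕜] {d k N : ℕ}

theorem exists_complement (hN : d + k = N) (G : Matrix (Fin k) (Fin N) 𝕜) (hG : G * Gᴴ = 1) :
    ∃ F : Matrix (Fin d) (Fin N) 𝕜, F * Fᴴ = 1 ∧ F * Gᴴ = 0 ∧ G * Fᴴ = 0 ∧
      Fᴴ * F + Gᴴ * G = 1 := by
  let v : Fin d ⊕ Fin k → EuclideanSpace 𝕜 (Fin N) :=
    Sum.elim (fun _ => 0) (fun j => WithLp.toLp 2 (G j))
  have hv : Orthonormal 𝕜 ((Set.range Sum.inr : Set (Fin d ⊕ Fin k)).domRestrict v) := by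
    rw [orthonormal_iff_ite]
    rintro ⟨_, i, rfl⟩ ⟨_, j, rfl⟩
    have := congrFun (congrFun hG j) i
    simp only [Matrix.mul_apply, conjTranspose_apply, Matrix.one_apply] at this
    simp only [Set.domRestrict_apply, v, Sum.elim_inr, PiLp.inner_apply, RCLike.inner_apply]
    refine this.trans ?_
    by_cases hij : i = j
    · subst hij; simp
    · rw [if_neg (Ne.symm hij), if_neg]
      intro h
      exact hij (Sum.inr_injective (Subtype.mk.inj h))
  obtain ⟨b, hb⟩ := hv.exists_orthonormalBasis_extension_of_card_eq (by simp [hN])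
  have hbG : ∀ j i, b (Sum.inr j) i = G j i := by
    intro j i; rw [hb _ ⟨j, rfl⟩]; rfl
  let F : Matrix (Fin d) (Fin N) 𝕜 := Matrix.of fun j i => b (Sum.inl j) i
  have hM : fromRows F G = Matrix.of fun j i => b j i := by
    ext (j | j) i
    · rfl
    · simp [hbG]
  have hMM : fromRows F G * (fromRows F G)ᴴ = 1 := by
    rw [hM]
    ext i j
    have := orthonormal_iff_ite.1 b.orthonormal j i
    simp only [PiLp.inner_apply, RCLike.inner_apply] at this
    simp only [Matrix.mul_apply, conjTranspose_apply, Matrix.one_apply, of_apply, eq_comm (a := i)]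
    rw [← this]
    rfl
  have hMM' := (mul_eq_one_comm_of_card_eq _ _ _ (by simp [hN])).1 hMM
  rw [
    conjTranspose_fromRows_eq_fromCols_conjTranspose, fromCols_mul_fromRows] at hMM'
  rw [conjTranspose_fromRows_eq_fromCols_conjTranspose, fromRows_mul_fromCols, ← fromBlocks_one,
    fromBlocks_inj] at hMM
  exact ⟨F, hMM.1, hMM.2.1, hMM.2.2.1, hMM'⟩

theorem stack_unit {F : Matrix (Fin d) (Fin N) 𝕜} {G : Matrix (Fin k) (Fin N) 𝕜}
    (h1 : F * Fᴴ = 1) (h2 : F * Gᴴ = 0) (h3 : G * Fᴴ = 0) (h4 : G * Gᴴ = 1) :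
    fromRows F G * (fromRows F G)ᴴ = 1 := by
  rw [conjTranspose_fromRows_eq_fromCols_conjTranspose, fromRows_mul_fromCols, h1, h2, h3, h4,
    fromBlocks_one]

theorem main_dir (hN : d + k = N) (hd : 1 ≤ d) (Φ : Matrix (Fin N) (Fin N) 𝕜 → Prop)
    (h : IsPathConnected {F : Matrix (Fin d) (Fin N) 𝕜 | F * Fᴴ = 1 ∧ Φ (Fᴴ * F)}) :
    IsPathConnected {G : Matrix (Fin k) (Fin N) 𝕜 | G * Gᴴ = 1 ∧ Φ (1 - Gᴴ * G)} := by
  rw [isPathConnected_iff]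
  constructor
  · obtain ⟨F, hF1, hF2⟩ := h.nonempty
    obtain ⟨G, hG, -, -, hs⟩ := exists_complement (d := k) (k := d) (by omega) F hF1
    refine ⟨G, hG, ?_⟩
    rw [← hs, add_sub_cancel_left]
    exact hF2
  rintro G0 ⟨hG0, hG0'⟩ G1 ⟨hG1, hG1'⟩
  obtain ⟨F0, hF0, hFG0, hGF0, hs0⟩ := exists_complement hN G0 hG0
  obtain ⟨E1, hE1, hEG1, hGE1, hs1⟩ := exists_complement hN G1 hG1
  have e0 : 1 - G0ᴴ * G0 = F0ᴴ * F0 := by rw [← hs0, add_sub_cancel_right]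
  have e1 : 1 - G1ᴴ * G1 = E1ᴴ * E1 := by rw [← hs1, add_sub_cancel_right]
  rw [e0] at hG0'
  rw [e1] at hG1'
  set M0 := fromRows F0 G0 with hM0d
  have hM0 : M0 * M0ᴴ = 1 := stack_unit hF0 hFG0 hGF0 hG0
  have hM0' : M0ᴴ * M0 = 1 := (mul_eq_one_comm_of_card_eq _ _ _ (by simp [hN])).1 hM0
  have hM1 : fromRows E1 G1 * (fromRows E1 G1)ᴴ = 1 := stack_unit hE1 hEG1 hGE1 hG1
  -- the determinant correction
  set z : 𝕜 := (fromRows E1 G1 * M0ᴴ).det with hz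
  have hz1 : z * star z = 1 := by
    apply det_circle
    rw [conjTranspose_mul, conjTranspose_conjTranspose, Matrix.mul_assoc, ← Matrix.mul_assoc M0ᴴ,
      hM0', Matrix.one_mul, hM1]
  have hz2 : star z * z = 1 := by rw [mul_comm]; exact hz1
  set W : Matrix (Fin d) (Fin d) 𝕜 := diagonal (Function.update 1 ⟨0, hd⟩ (star z)) with hW
  have hWdet : W.det = star z := by
    rw [hW, det_diagonal, Finset.prod_update_of_mem (Finset.mem_univ _)]
    simp
  have hW1 : W * Wᴴ = 1 := by
    rw [hW, diagonal_conjTranspose, diagonal_mul_diagonal, ← diagonal_one]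
    congr 1
    ext i
    by_cases hi : i = ⟨0, hd⟩
    · subst hi; simpa using hz2
    · simp [Function.update_of_ne hi]
  set F1 := W * E1 with hF1d
  have hF1g : F1ᴴ * F1 = E1ᴴ * E1 := by
    rw [hF1d, conjTranspose_mul, Matrix.mul_assoc, ← Matrix.mul_assoc Wᴴ, unit_comm hW1,
      Matrix.one_mul]
  have hF1 : F1 * F1ᴴ = 1 := by
    rw [hF1d, conjTranspose_mul, Matrix.mul_assoc, ← Matrix.mul_assoc E1, hE1, Matrix.one_mul, hW1]
  have hGF1 : G1 * F1ᴴ = 0 := by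
    rw [hF1d, conjTranspose_mul, ← Matrix.mul_assoc, hGE1, Matrix.zero_mul]
  have hs1' : F1ᴴ * F1 + G1ᴴ * G1 = 1 := by rw [hF1g, hs1]
  have hstack : fromRows F1 G1 = fromBlocks W 0 0 (1 : Matrix (Fin k) (Fin k) 𝕜) * fromRows E1 G1 := by
    rw [fromBlocks_mul_fromRows]; simp [hF1d]
  have hdet1 : (fromRows F1 G1 * M0ᴴ).det = 1 := by
    rw [hstack, Matrix.mul_assoc, det_mul, det_fromBlocks_zero₁₂, det_one, mul_one, hWdet, ← hz, hz2]
  -- lift the path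
  obtain ⟨T, hT, hFT⟩ := liftRel_of_joinedIn (fun u hu => hu.1)
    (h.joinedIn F0 ⟨hF0, hG0'⟩ F1 ⟨hF1, by rwa [hF1g]⟩)
  have hT1 : T * Tᴴ = 1 := hT.target_mem.1
  have step1 : JoinedIn {G : Matrix (Fin k) (Fin N) 𝕜 | G * Gᴴ = 1 ∧ Φ (1 - Gᴴ * G)}
      G0 (G0 * T) := by
    have := hT.mapsTo (f := fun R => G0 * R)
      (B := {G : Matrix (Fin k) (Fin N) 𝕜 | G * Gᴴ = 1 ∧ Φ (1 - Gᴴ * G)}) (by fun_prop) (by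
      rintro R ⟨hR, -, hR2⟩
      refine ⟨?_, ?_⟩
      · rw [conjTranspose_mul, Matrix.mul_assoc, ← Matrix.mul_assoc R, hR, Matrix.one_mul, hG0]
      · have : 1 - (G0 * R)ᴴ * (G0 * R) = (F0 * R)ᴴ * (F0 * R) := by
          have a : (G0 * R)ᴴ * (G0 * R) = Rᴴ * (G0ᴴ * G0) * R := by
            simp only [conjTranspose_mul, Matrix.mul_assoc]
          have b : (F0 * R)ᴴ * (F0 * R) = Rᴴ * (F0ᴴ * F0) * R := by
            simp only [conjTranspose_mul, Matrix.mul_assoc]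
          rw [a, b, ← e0, Matrix.mul_sub, Matrix.sub_mul, Matrix.mul_one, unit_comm hR]
        rwa [this])
    simpa using this
  set V : Matrix (Fin k) (Fin k) 𝕜 := G0 * T * G1ᴴ with hV
  have hVG : G0 * T = V * G1 := by
    have : G0 * T * F1ᴴ = 0 := by
      rw [← hFT, conjTranspose_mul, Matrix.mul_assoc, ← Matrix.mul_assoc T, hT1, Matrix.one_mul,
        hGF0]
    calc G0 * T = G0 * T * (F1ᴴ * F1 + G1ᴴ * G1) := by rw [hs1', Matrix.mul_one]
      _ = G0 * T * F1ᴴ * F1 + G0 * T * G1ᴴ * G1 := by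
        rw [Matrix.mul_add]; simp only [Matrix.mul_assoc]
      _ = V * G1 := by rw [this, Matrix.zero_mul, zero_add]
  have hV1 : V * Vᴴ = 1 := by
    have : (V * G1) * (V * G1)ᴴ = 1 := by
      rw [← hVG, conjTranspose_mul, Matrix.mul_assoc, ← Matrix.mul_assoc T, hT1, Matrix.one_mul,
        hG0]
    rwa [conjTranspose_mul, Matrix.mul_assoc, ← Matrix.mul_assoc G1, hG1, Matrix.one_mul] at this
  have hVdet : V.det = T.det := by
    have : M0 * T * M0ᴴ = fromBlocks (1 : Matrix (Fin d) (Fin d) 𝕜) 0 0 V * (fromRows F1 G1 * M0ᴴ) := by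
      rw [← Matrix.mul_assoc, fromBlocks_mul_fromRows, hM0d, fromRows_mul, hFT, hVG]
      simp
    rw [← det_conj_of_mul_eq_one (N := T) hM0 hM0', this, det_mul, hdet1, det_fromBlocks_zero₁₂]
    simp
  have hVj := uconn_fin k V hV1 (by
    rw [hVdet]
    have := (joinedIn_det (hT.mono (V := {T : Matrix (Fin N) (Fin N) 𝕜 | T * Tᴴ = 1})
      fun _ h => h.1)).symm
    simpa using this)
  refine step1.trans ?_
  rw [hVG]
  have := hVj.mapsTo (f := fun R => R * G1)
      (B := {G : Matrix (Fin k) (Fin N) 𝕜 | G * Gᴴ = 1 ∧ Φ (1 - Gᴴ * G)}) (by fun_prop) (by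
      intro R hR
      have hR : R * Rᴴ = 1 := hR
      refine ⟨?_, ?_⟩
      · rw [conjTranspose_mul, Matrix.mul_assoc, ← Matrix.mul_assoc G1, hG1, Matrix.one_mul, hR]
      · rw [conjTranspose_mul, Matrix.mul_assoc, ← Matrix.mul_assoc Rᴴ, unit_comm hR,
          Matrix.one_mul, e1]
        exact hG1')
  simpa using this

end main

section final

variable {𝕜 : Type*} [RCLike 𝕜] {d k N : ℕ}

/-- Gram-matrix version of orthodecomposability. -/
def ODG (P : Matrix (Fin N) (Fin N) 𝕜) : Prop :=
  ∃ S T : Set (Fin N), S.Nonempty ∧ T.Nonempty ∧ Disjoint S T ∧ S ∪ T = Set.univ ∧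
    ∀ s ∈ S, ∀ t ∈ T, P s t = 0

theorem gram_inner (F : Matrix (Fin d) (Fin N) 𝕜) (s t : Fin N) :
    inner 𝕜 (_root_.col F s) (_root_.col F t) = (Fᴴ * F) s t := by
  simp only [PiLp.inner_apply, RCLike.inner_apply, Matrix.mul_apply, conjTranspose_apply]
  refine Finset.sum_congr rfl fun i _ => ?_
  rw [mul_comm]
  rfl

theorem od_iff (F : Matrix (Fin d) (Fin N) 𝕜) (c : 𝕜) (hc : c ≠ 0) (hF : F * Fᴴ = c • 1) :
    Orthodecomposable 𝕜 (_root_.col F) ↔ ODG (Fᴴ * F) := by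
  constructor
  · rintro ⟨S, T, hS, hT, hd, hu, h⟩
    refine ⟨S, T, hS, hT, hd, hu, fun s hs t ht => ?_⟩
    have h1 : _root_.col F s ∈ (Submodule.span 𝕜 (_root_.col F '' T))ᗮ := by
      rw [← h]; exact Submodule.subset_span ⟨s, hs, rfl⟩
    rw [← gram_inner]
    exact Submodule.inner_left_of_mem_orthogonal
      (Submodule.subset_span (Set.mem_image_of_mem _ ht)) h1
  · rintro ⟨S, T, hS, hT, hd, hu, h⟩
    refine ⟨S, T, hS, hT, hd, hu, le_antisymm ?_ ?_⟩
    · rw [Submodule.span_le]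
      rintro _ ⟨s, hs, rfl⟩
      rw [SetLike.mem_coe, Submodule.mem_orthogonal']
      intro u hu
      induction hu using Submodule.span_induction with
      | mem x hx =>
        obtain ⟨t, ht, rfl⟩ := hx
        rw [gram_inner, h s hs t ht]
      | zero => simp
      | add x y _ _ hx hy => rw [inner_add_right, hx, hy, add_zero]
      | smul a x _ hx => rw [inner_smul_right, hx, mul_zero]
    · intro x hx
      have key : c • x = ∑ n, (inner 𝕜 (_root_.col F n) x) • _root_.col F n := by
        have e : (F * Fᴴ) *ᵥ (fun i => x i) = c • (fun i => x i) := by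
          rw [hF, smul_mulVec, one_mulVec]
        ext i
        have := congrFun e i
        rw [← mulVec_mulVec] at this
        simp only [mulVec, dotProduct, Pi.smul_apply] at this
        rw [PiLp.smul_apply, ← this, WithLp.ofLp_sum, Finset.sum_apply]
        refine Finset.sum_congr rfl fun n _ => ?_
        rw [PiLp.smul_apply, smul_eq_mul, mul_comm]
        congr 1
        simp only [PiLp.inner_apply, RCLike.inner_apply, conjTranspose_apply]
        refine Finset.sum_congr rfl fun j _ => ?_
        rw [mul_comm]
        rfl
      have hcx : c • x ∈ Submodule.span 𝕜 (_root_.col F '' S) := by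
        rw [key]
        refine Submodule.sum_mem _ fun n _ => ?_
        have hn : n ∈ S ∪ T := by rw [hu]; trivial
        rcases hn with hn | hn
        · exact Submodule.smul_mem _ _ (Submodule.subset_span ⟨n, hn, rfl⟩)
        · rw [Submodule.inner_right_of_mem_orthogonal
            (Submodule.subset_span (Set.mem_image_of_mem _ hn)) hx, zero_smul]
          exact Submodule.zero_mem _
      have := Submodule.smul_mem _ c⁻¹ hcx
      rwa [smul_smul, inv_mul_cancel₀ hc, one_smul] at this

/-- Condition on the normalised Gram matrix. -/
def GoodProj (d : ℕ) (P : Matrix (Fin N) (Fin N) 𝕜) : Prop :=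
  (∀ n, P n n = (d : 𝕜) / (N : 𝕜)) ∧ ¬ ODG P

theorem goodProj_compl (hN : d + k = N) (hN0 : 0 < N) (P : Matrix (Fin N) (Fin N) 𝕜) :
    GoodProj k (1 - P) ↔ GoodProj d P := by
  have hN' : (N : 𝕜) ≠ 0 := by exact_mod_cast hN0.ne'
  have hsum : (d : 𝕜) / N + k / N = 1 := by
    rw [← add_div, ← Nat.cast_add, hN, div_self hN']
  refine and_congr (forall_congr' fun n => ?_) (not_congr ?_)
  · rw [Matrix.sub_apply, one_apply_eq]
    constructor
    · intro h; linear_combination -h - hsum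
    · intro h; linear_combination -h - hsum
  · unfold ODG
    refine exists_congr fun S => exists_congr fun T => and_congr_right fun _ =>
      and_congr_right fun _ => and_congr_right fun hd => and_congr_right fun _ =>
      forall_congr' fun s => forall_congr' fun hs => forall_congr' fun t =>
      forall_congr' fun ht => ?_
    have : s ≠ t := fun h => Set.disjoint_left.1 hd hs (h ▸ ht)
    rw [Matrix.sub_apply, Matrix.one_apply_ne this, zero_sub, neg_eq_zero]

theorem scale_iff (hd : 0 < d) (hN : 0 < N) :
    IsPathConnected {F ∈ FUNTF 𝕜 N d | ¬ Orthodecomposable 𝕜 (_root_.col F)} ↔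
    IsPathConnected {F : Matrix (Fin d) (Fin N) 𝕜 | F * Fᴴ = 1 ∧ GoodProj d (Fᴴ * F)} := by
  have hd' : (d : 𝕜) ≠ 0 := by exact_mod_cast hd.ne'
  have hN' : (N : 𝕜) ≠ 0 := by exact_mod_cast hN.ne'
  set r : 𝕜 := ((Real.sqrt (d / N) : ℝ) : 𝕜) with hr
  have hrs : star r = r := by simp [hr]
  have hrr : r * r = (d : 𝕜) / N := by
    rw [hr, ← RCLike.ofReal_mul, Real.mul_self_sqrt (by positivity)]
    push_cast; rfl
  have hq : (d : 𝕜) / N ≠ 0 := div_ne_zero hd' hN'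
  have hr0 : r ≠ 0 := by
    intro h; rw [h, mul_zero] at hrr; exact hq hrr.symm
  rw [← (Homeomorph.smulOfNeZero (α := Matrix (Fin d) (Fin N) 𝕜) r hr0).isPathConnected_preimage
    (s := {F : Matrix (Fin d) (Fin N) 𝕜 | F * Fᴴ = 1 ∧ GoodProj d (Fᴴ * F)})]
  congr! 1
  ext F
  have e1 : (r • F) * (r • F)ᴴ = ((d : 𝕜) / N) • (F * Fᴴ) := by
    rw [conjTranspose_smul, hrs, Matrix.smul_mul, Matrix.mul_smul, smul_smul, hrr]
  have e2 : (r • F)ᴴ * (r • F) = ((d : 𝕜) / N) • (Fᴴ * F) := by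
    rw [conjTranspose_smul, hrs, Matrix.smul_mul, Matrix.mul_smul, smul_smul, hrr]
  have a1 : F * Fᴴ = ((N : 𝕜) / d) • 1 ↔ (r • F) * (r • F)ᴴ = 1 := by
    rw [e1]
    constructor
    · intro h; rw [h, smul_smul, div_mul_div_cancel₀ hN', div_self hd', one_smul]
    · intro h; rw [← h, smul_smul, div_mul_div_cancel₀ hd', div_self hN', one_smul]
  have a2 : (∀ n, (Fᴴ * F) n n = 1) ↔ ∀ n, ((r • F)ᴴ * (r • F)) n n = (d : 𝕜) / N := by
    refine forall_congr' fun n => ?_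
    rw [e2, Matrix.smul_apply, smul_eq_mul]
    constructor
    · intro h; rw [h, mul_one]
    · intro h; exact mul_left_cancel₀ hq (by rw [h, mul_one])
  have a3 : ODG ((r • F)ᴴ * (r • F)) ↔ ODG (Fᴴ * F) := by
    rw [e2]; unfold ODG
    simp only [Matrix.smul_apply, smul_eq_mul, mul_eq_zero, hq, false_or]
  show (F * Fᴴ = _ ∧ _) ∧ _ ↔ (r • F) * (r • F)ᴴ = 1 ∧ GoodProj d ((r • F)ᴴ * (r • F))
  unfold GoodProj
  rw [a3, ← a1, ← a2, and_assoc]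
  refine and_congr_right fun h => and_congr_right fun _ => not_congr ?_
  exact od_iff F _ (div_ne_zero hN' hd') h

theorem half (hN : d + k = N) (hd : 0 < d) (hk : 0 < k)
    (h : IsPathConnected {F ∈ FUNTF 𝕜 N d | ¬ Orthodecomposable 𝕜 (_root_.col F)}) :
    IsPathConnected {F ∈ FUNTF 𝕜 N k | ¬ Orthodecomposable 𝕜 (_root_.col F)} := by
  rw [scale_iff hd (by omega)] at h
  rw [scale_iff hk (by omega)]
  have := main_dir hN hd (GoodProj d) h
  simpa only [goodProj_compl (d := k) (k := d) (show k + d = N by omega)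
    (show 0 < N by omega)] using this

end final

end helpers

/-- For `N > d ≥ 1`, the set of non-orthodecomposable frames in `𝓕_{N,d}` is path-connected
if and only if the set of non-orthodecomposable frames in `𝓕_{N,N-d}` is path-connected. -/
theorem nod_pathConnected_iff_naimark (𝕜 : Type*) [RCLike 𝕜] (N d : ℕ)
    (hd : 1 ≤ d) (hdN : d < N) :
    IsPathConnected {F ∈ FUNTF 𝕜 N d | ¬ Orthodecomposable 𝕜 (col F)} ↔
      IsPathConnected {F ∈ FUNTF 𝕜 N (N - d) | ¬ Orthodecomposable 𝕜 (col F)} := by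
  exact ⟨half (d := d) (k := N - d) (N := N) (by omega) (by omega) (by omega),
    half (d := N - d) (k := d) (N := N) (by omega) (by omega) (by omega)⟩
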